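/- arXiv:2406.04958 — 4 statements merged into one kernel-verified Lean document; each statement's English description precedes it below -/
import Mathlib

section
/- Let n ≥ 2 and let P ∈ ℝ^{n×n} be a row-stochastic matrix that is irreducible and aperiodic (equivalently, some power P^m has all entries strictly positive). Then the matrix I_{n²} − (P⊗P)E is invertible. -/
open Matrix Kronecker BigOperators

/-- The "meeting" diagonal matrix `E`: diagonal 0/1 matrix on the product space with
`E_{(i,j),(i,j)} = 1` iff `i ≠ j`. -/
noncomputable def Ekill (n : ℕ) : Matrix (Fin n × Fin n) (Fin n × Fin n) ℝ :=
  Matrix.diagonal fun p => if p.1 ≠ p.2 then 1 else 0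

/-- One step of the maximum principle. -/
lemma max_step {n : ℕ} (P : Matrix (Fin n) (Fin n) ℝ)
    (hnonneg : ∀ i j, 0 ≤ P i j) (hrow : ∀ i, ∑ j, P i j = 1)
    (v : Fin n × Fin n → ℝ) (M : ℝ) (hM : 0 < M) (hle : ∀ q, |v q| ≤ M)
    (hv : ∀ p, v p = ∑ q : Fin n × Fin n, P p.1 q.1 * P p.2 q.2 * (if q.1 ≠ q.2 then v q else 0))
    (p q : Fin n × Fin n) (hp : |v p| = M) (h1 : 0 < P p.1 q.1) (h2 : 0 < P p.2 q.2) :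
    |v q| = M ∧ q.1 ≠ q.2 := by
  have hsum : ∑ q : Fin n × Fin n, P p.1 q.1 * P p.2 q.2 = 1 := by
    rw [Fintype.sum_prod_type, ← Finset.sum_mul_sum, hrow, hrow, one_mul]
  have hb : ∀ q : Fin n × Fin n, |if q.1 ≠ q.2 then v q else 0| ≤ M := by
    intro q
    split_ifs
    · exact hle q
    · simpa using hM.le
  have hkey : |if q.1 ≠ q.2 then v q else 0| = M := by
    by_contra hne
    have hlt := lt_of_le_of_ne (hb q) hne
    have : |v p| < M := by
      calc |v p| ≤ ∑ q : Fin n × Fin n, |P p.1 q.1 * P p.2 q.2 * (if q.1 ≠ q.2 then v q else 0)| := by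
            rw [hv p]; exact Finset.abs_sum_le_sum_abs _ _
        _ < ∑ q : Fin n × Fin n, P p.1 q.1 * P p.2 q.2 * M := by
            apply Finset.sum_lt_sum
            · intro r _
              have h0 := mul_nonneg (hnonneg p.1 r.1) (hnonneg p.2 r.2)
              rw [abs_mul, abs_of_nonneg h0]
              exact mul_le_mul_of_nonneg_left (hb r) h0
            · refine ⟨q, Finset.mem_univ _, ?_⟩
              have h0 := mul_pos h1 h2
              rw [abs_mul, abs_of_pos h0]
              exact mul_lt_mul_of_pos_left hlt h0
        _ = M := by rw [← Finset.sum_mul, hsum, one_mul]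
    exact this.ne hp
  by_cases hq : q.1 ≠ q.2
  · rw [if_pos hq] at hkey
    exact ⟨hkey, hq⟩
  · rw [if_neg hq, abs_zero] at hkey
    exact absurd hkey hM.ne

lemma exists_pos_step {n : ℕ} (P : Matrix (Fin n) (Fin n) ℝ)
    (hnonneg : ∀ i j, 0 ≤ P i j) (k : ℕ) (i a : Fin n) (h : 0 < (P ^ (k + 1)) i a) :
    ∃ c, 0 < (P ^ k) i c ∧ 0 < P c a := by
  rw [pow_succ, Matrix.mul_apply] at h
  obtain ⟨c, _, hc⟩ := Finset.exists_lt_of_sum_lt (s := Finset.univ) (f := fun _ : Fin n => (0 : ℝ))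
    (g := fun c => (P ^ k) i c * P c a) (by simpa using h)
  have h2 : 0 < P c a := by
    refine lt_of_le_of_ne (hnonneg c a) fun h0 => ?_
    simp [← h0] at hc
  exact ⟨c, pos_of_mul_pos_left hc h2.le, h2⟩

/-- for `n ≥ 2` and a row-stochastic, irreducible and aperiodic matrix `P`
(i.e. some power of `P` has all entries strictly positive), the matrix
`I_{n²} − (P ⊗ P) E` is invertible. -/
theorem stmt0 (n : ℕ) (hn : 2 ≤ n) (P : Matrix (Fin n) (Fin n) ℝ)
    (hnonneg : ∀ i j, 0 ≤ P i j) (hrow : ∀ i, ∑ j, P i j = 1)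
    (hprim : ∃ m : ℕ, ∀ i j, 0 < (P ^ m) i j) :
    IsUnit ((1 : Matrix (Fin n × Fin n) (Fin n × Fin n) ℝ) - (P ⊗ₖ P) * Ekill n) := by
  rw [← Matrix.mulVec_injective_iff_isUnit]
  rw [← Matrix.coe_mulVecLin, injective_iff_map_eq_zero]
  intro v hv0
  rw [Matrix.mulVecLin_apply, Matrix.sub_mulVec, Matrix.one_mulVec, sub_eq_zero] at hv0
  have hv : ∀ p, v p = ∑ q : Fin n × Fin n,
      P p.1 q.1 * P p.2 q.2 * (if q.1 ≠ q.2 then v q else 0) := by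
    intro p
    conv_lhs => rw [hv0]
    simp only [Matrix.mulVec, dotProduct, Ekill, Matrix.mul_diagonal, Matrix.kroneckerMap_apply]
    refine Finset.sum_congr rfl fun q _ => ?_
    split_ifs <;> simp
  have : Nonempty (Fin n × Fin n) := ⟨(⟨0, by omega⟩, ⟨0, by omega⟩)⟩
  obtain ⟨p, hp⟩ := Finite.exists_max fun q => |v q|
  by_contra hne
  have hM : 0 < |v p| := by
    obtain ⟨q, hq⟩ := Function.ne_iff.mp hne
    exact lt_of_lt_of_le (abs_pos.mpr hq) (hp q)
  have key : ∀ k a b, 0 < (P ^ k) p.1 a → 0 < (P ^ k) p.2 b →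
      |v (a, b)| = |v p| ∧ (k = 0 ∨ a ≠ b) := by
    intro k
    induction k with
    | zero =>
      intro a b ha hb
      rw [pow_zero, Matrix.one_apply] at ha hb
      split_ifs at ha hb with h1 h2
      · subst h1 h2
        exact ⟨rfl, Or.inl rfl⟩
      all_goals simp at ha hb
    | succ k ih =>
      intro a b ha hb
      obtain ⟨c, hc, hca⟩ := exists_pos_step P hnonneg k _ _ ha
      obtain ⟨d, hd, hdb⟩ := exists_pos_step P hnonneg k _ _ hb
      have := max_step P hnonneg hrow v |v p| hM hp hv (c, d) (a, b) (ih c d hc hd).1 hca hdb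
      exact ⟨this.1, Or.inr this.2⟩
  obtain ⟨m, hm⟩ := hprim
  rcases (key m p.1 p.1 (hm _ _) (hm _ _)).2 with h | h
  · subst h
    have := hm ⟨0, by omega⟩ ⟨1, by omega⟩
    simp [Matrix.one_apply] at this
  · exact h rfl
end

section
/- Let P ∈ ℝ^{n×n} be row-stochastic with stationary probability vector π (i.e. πᵀP = πᵀ, π_i ≥ 0, Σ_i π_i = 1). If M ∈ ℝ^{n×n} satisfies M = 1_n 1_nᵀ + P (M − M_d) Pᵀ, where M_d is the diagonal matrix with (M_d)_{ii} = M_{ii}, then Σ_{i=1}^n π_i² M_{ii} = 1, i.e. πᵀ M_d π = 1. -/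
open Matrix BigOperators

/-- if `P` is row-stochastic with stationary probability vector `π` and
`M = 1 1ᵀ + P (M − M_d) Pᵀ`, then `∑ i, π i ^ 2 * M i i = 1`. -/
theorem stmt2 (n : ℕ) (P : Matrix (Fin n) (Fin n) ℝ)
    (hnonneg : ∀ i j, 0 ≤ P i j) (hrow : ∀ i, ∑ j, P i j = 1)
    (π : Fin n → ℝ) (hπnonneg : ∀ i, 0 ≤ π i) (hπsum : ∑ i, π i = 1)
    (hstat : π ᵥ* P = π)
    (M : Matrix (Fin n) (Fin n) ℝ)
    (hM : M = Matrix.of (fun _ _ => (1 : ℝ)) +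
      P * (M - Matrix.diagonal fun i => M i i) * Pᵀ) :
    ∑ i, π i ^ 2 * M i i = 1 := by
  have h1 : (π ᵥ* M) ⬝ᵥ π = (π ᵥ* (Matrix.of (fun _ _ => (1 : ℝ)) +
      P * (M - Matrix.diagonal fun i => M i i) * Pᵀ)) ⬝ᵥ π :=
    congrArg (fun A => (π ᵥ* A) ⬝ᵥ π) hM
  have h2 : Pᵀ *ᵥ π = π := by rw [Matrix.mulVec_transpose, hstat]
  have h3 : (π ᵥ* (Matrix.of (fun _ _ => (1 : ℝ)) : Matrix (Fin n) (Fin n) ℝ)) ⬝ᵥ π = 1 := by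
    have : π ᵥ* (Matrix.of (fun _ _ => (1 : ℝ)) : Matrix (Fin n) (Fin n) ℝ) = fun _ => 1 := by
      ext j
      simp [Matrix.vecMul, dotProduct, hπsum]
    rw [this]
    simp [dotProduct, hπsum]
  rw [Matrix.vecMul_add, add_dotProduct, h3, ← Matrix.vecMul_vecMul, ← Matrix.dotProduct_mulVec _ Pᵀ,
    h2, ← Matrix.vecMul_vecMul, hstat, Matrix.vecMul_sub, sub_dotProduct] at h1
  have h4 : (π ᵥ* Matrix.diagonal fun i => M i i) ⬝ᵥ π = ∑ i, π i ^ 2 * M i i := by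
    simp only [dotProduct, Matrix.vecMul_diagonal]
    exact Finset.sum_congr rfl fun i _ => by ring
  linarith
end

section
/- Let P ∈ ℝ^{n×n} be row-stochastic with stationary probability vector π. Suppose L_kill := I_{n²} − (P⊗P)E is invertible and admits a singular value decomposition L_kill = Σ_{i=1}^{n²} σ̃_i ũ_i ṽ_iᵀ with (ũ_i), (ṽ_i) orthonormal bases of ℝ^{n²} and σ̃₁ ≥ … ≥ σ̃_{n²} > 0. For 1 ≤ k ≤ n²−1 define the rank-k approximation t̂^{(k)} := −1 + Σ_{i=n²−k+1}^{n²} (1/σ̃_i) · ((π⊗π)ᵀ ṽ_i) · (ũ_iᵀ 1_{n²}), and let t^π := (π⊗π)ᵀ E L_kill^{-1} 1_{n²}. Then |t̂^{(k)} − t^π| ≤ n‖π‖² / σ̃_{n²−k}. -/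
open Matrix Kronecker BigOperators

theorem parseval_aux (n : ℕ) (v : Fin (n ^ 2) → (Fin n × Fin n → ℝ))
    (hv : ∀ i j, v i ⬝ᵥ v j = if i = j then 1 else 0) (a b : Fin n × Fin n → ℝ) :
    ∑ i, (a ⬝ᵥ v i) * (v i ⬝ᵥ b) = a ⬝ᵥ b := by
  let V : Matrix (Fin (n ^ 2)) (Fin n × Fin n) ℝ := Matrix.of v
  have h1 : V * Vᵀ = 1 := by
    ext i j
    rw [Matrix.one_apply, ← hv i j]
    rfl
  have h2 : Vᵀ * V = 1 :=
    (Matrix.mul_eq_one_comm_of_card_eq _ _ _ (by simp [sq])).1 h1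
  have h3 : a ⬝ᵥ ((Vᵀ * V) *ᵥ b) = a ⬝ᵥ b := by rw [h2, one_mulVec]
  rw [← h3, ← mulVec_mulVec, dotProduct_mulVec, vecMul_transpose]
  simp only [dotProduct, mulVec, V, Matrix.of_apply]
  refine Finset.sum_congr rfl fun i _ => ?_
  congr 1
  exact Finset.sum_congr rfl fun p _ => mul_comm _ _

/-- rank-`k` approximation bound for the expected meeting time from
stationarity.  Here singular values are indexed by `Fin (n²)` (0-based), so the paper's
`σ̃_i` is `σ ⟨i-1, _⟩`; the rank-`k` approximation sums over the `k` least singular values,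
i.e. over indices `i` with `n² - k ≤ i`, and the paper's `σ̃_{n²-k}` is `σ ⟨n² - k - 1, _⟩`. -/
theorem stmt4 (n : ℕ) (P : Matrix (Fin n) (Fin n) ℝ)
    (hnonneg : ∀ i j, 0 ≤ P i j) (hrow : ∀ i, ∑ j, P i j = 1)
    (π : Fin n → ℝ) (hπnonneg : ∀ i, 0 ≤ π i) (hπsum : ∑ i, π i = 1)
    (hstat : π ᵥ* P = π)
    (Lkill : Matrix (Fin n × Fin n) (Fin n × Fin n) ℝ)
    (hLkill : Lkill = (1 : Matrix (Fin n × Fin n) (Fin n × Fin n) ℝ) - (P ⊗ₖ P) * Ekill n)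
    (hunit : IsUnit Lkill)
    (σ : Fin (n ^ 2) → ℝ) (u v : Fin (n ^ 2) → (Fin n × Fin n → ℝ))
    (hu : ∀ i j, u i ⬝ᵥ u j = if i = j then 1 else 0)
    (hv : ∀ i j, v i ⬝ᵥ v j = if i = j then 1 else 0)
    (hσmono : ∀ i j : Fin (n ^ 2), i ≤ j → σ j ≤ σ i)
    (hσpos : ∀ i, 0 < σ i)
    (hSVD : Lkill = ∑ i, σ i • vecMulVec (u i) (v i))
    (k : ℕ) (hk1 : 1 ≤ k) (hk2 : k ≤ n ^ 2 - 1) :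
    |(-1 + ∑ i ∈ Finset.univ.filter (fun i : Fin (n ^ 2) => n ^ 2 - k ≤ (i : ℕ)),
        (1 / σ i) * ((fun p : Fin n × Fin n => π p.1 * π p.2) ⬝ᵥ v i) *
          (u i ⬝ᵥ fun _ => 1))
      - (fun p : Fin n × Fin n => π p.1 * π p.2) ⬝ᵥ ((Ekill n * Lkill⁻¹) *ᵥ fun _ => 1)|
      ≤ (n : ℝ) * (∑ i, π i ^ 2) /
          σ ⟨n ^ 2 - k - 1, by
            have h : 0 < n ^ 2 :=
              lt_of_lt_of_le Nat.one_pos (hk1.trans (hk2.trans (Nat.sub_le _ _)))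
            exact lt_of_le_of_lt (Nat.sub_le_sub_right (Nat.sub_le _ _) 1)
              (Nat.sub_lt h Nat.one_pos)⟩ := by
  have hq1 : (fun p : Fin n × Fin n => π p.1 * π p.2) ⬝ᵥ (fun _ => (1 : ℝ)) = 1 := by
    simp only [dotProduct, mul_one]
    rw [Fintype.sum_prod_type]
    simp only [← Finset.mul_sum, hπsum, mul_one]
  have hqq : (fun p : Fin n × Fin n => π p.1 * π p.2) ⬝ᵥ
      (fun p : Fin n × Fin n => π p.1 * π p.2) = (∑ i, π i ^ 2) ^ 2 := by
    simp only [dotProduct]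
    rw [Fintype.sum_prod_type, sq, Finset.sum_mul_sum]
    refine Finset.sum_congr rfl fun i _ => Finset.sum_congr rfl fun j _ => ?_
    ring
  have hqP : (fun p : Fin n × Fin n => π p.1 * π p.2) ᵥ* (P ⊗ₖ P)
      = (fun p : Fin n × Fin n => π p.1 * π p.2) := by
    ext ⟨a, b⟩
    have ha := congrFun hstat a
    have hb := congrFun hstat b
    simp only [vecMul, dotProduct] at ha hb ⊢
    rw [Fintype.sum_prod_type]
    conv_rhs => rw [← ha, ← hb]
    rw [Finset.sum_mul_sum]
    refine Finset.sum_congr rfl fun i _ => Finset.sum_congr rfl fun j _ => ?_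
    simp only [kroneckerMap_apply]
    ring
  have h11 : (fun _ : Fin n × Fin n => (1 : ℝ)) ⬝ᵥ (fun _ => (1 : ℝ)) = (n : ℝ) ^ 2 := by
    simp [dotProduct, sq]
  have hS0 : 0 ≤ ∑ i, π i ^ 2 := Finset.sum_nonneg fun i _ => sq_nonneg _
  generalize (fun p : Fin n × Fin n => π p.1 * π p.2) = q at *
  generalize (∑ i, π i ^ 2) = S at *
  generalize hone : (fun _ : Fin n × Fin n => (1 : ℝ)) = e at *
  have hdet : IsUnit Lkill.det := (Matrix.isUnit_iff_isUnit_det _).1 hunit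
  obtain ⟨x, hx⟩ : ∃ x, x = Lkill⁻¹ *ᵥ e := ⟨_, rfl⟩
  have hLx : Lkill *ᵥ x = e := by
    rw [hx, mulVec_mulVec, Matrix.mul_nonsing_inv _ hdet, one_mulVec]
  have hqE : q ᵥ* Ekill n = q - q ᵥ* Lkill := by
    rw [hLkill, vecMul_sub, vecMul_one, ← vecMul_vecMul, hqP]
    simp
  have ht : q ⬝ᵥ ((Ekill n * Lkill⁻¹) *ᵥ e) = q ⬝ᵥ x - 1 := by
    rw [← mulVec_mulVec, ← hx, dotProduct_mulVec, hqE, sub_dotProduct, ← dotProduct_mulVec,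
      hLx, hq1]
  have hux : ∀ i, u i ⬝ᵥ e = σ i * (v i ⬝ᵥ x) := by
    intro i
    rw [← hLx, hSVD, Matrix.sum_mulVec, dotProduct_sum, Finset.sum_eq_single i]
    · rw [smul_mulVec, vecMulVec_mulVec]
      simp [hu]
    · intro j _ hj
      rw [smul_mulVec, vecMulVec_mulVec]
      simp [hu, hj.symm]
    · simp
  have hterm : ∀ i, (1 / σ i) * (q ⬝ᵥ v i) * (u i ⬝ᵥ e) = (q ⬝ᵥ v i) * (v i ⬝ᵥ x) := by
    intro i
    have := (hσpos i).ne'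
    rw [hux]
    field_simp
  have hfull : ∑ i, (1 / σ i) * (q ⬝ᵥ v i) * (u i ⬝ᵥ e) = q ⬝ᵥ x := by
    rw [← parseval_aux n v hv q x]
    exact Finset.sum_congr rfl fun i _ => hterm i
  rw [ht, ← hfull, ← Finset.sum_filter_add_sum_filter_not Finset.univ
    (fun i : Fin (n ^ 2) => n ^ 2 - k ≤ (i : ℕ))
    (fun i => (1 / σ i) * (q ⬝ᵥ v i) * (u i ⬝ᵥ e))]
  generalize hs : (⟨n ^ 2 - k - 1, _⟩ : Fin (n ^ 2)) = m
  have hm : (m : ℕ) = n ^ 2 - k - 1 := by rw [← hs]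
  have hCS : ∑ i, |q ⬝ᵥ v i| * |u i ⬝ᵥ e| ≤ n * S := by
    have h := Finset.sum_mul_sq_le_sq_mul_sq Finset.univ
      (fun i => |q ⬝ᵥ v i|) (fun i => |u i ⬝ᵥ e|)
    have ha : ∑ i, |q ⬝ᵥ v i| ^ 2 = S ^ 2 := by
      rw [← hqq, ← parseval_aux n v hv q q]
      refine Finset.sum_congr rfl fun i _ => ?_
      rw [sq_abs, sq, dotProduct_comm (v i) q]
    have hb : ∑ i, |u i ⬝ᵥ e| ^ 2 = (n : ℝ) ^ 2 := by
      rw [← h11, ← parseval_aux n u hu e e]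
      refine Finset.sum_congr rfl fun i _ => ?_
      rw [sq_abs, sq, dotProduct_comm (u i) e]
    rw [ha, hb, ← mul_pow] at h
    have := abs_le_of_sq_le_sq h (by positivity)
    linarith [le_abs_self (∑ i, |q ⬝ᵥ v i| * |u i ⬝ᵥ e|)]
  have hbound : |∑ i ∈ Finset.univ.filter (fun i : Fin (n ^ 2) => ¬ n ^ 2 - k ≤ (i : ℕ)),
      (1 / σ i) * (q ⬝ᵥ v i) * (u i ⬝ᵥ e)| ≤ n * S / σ m := by
    calc _ ≤ ∑ i ∈ Finset.univ.filter (fun i : Fin (n ^ 2) => ¬ n ^ 2 - k ≤ (i : ℕ)),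
          |(1 / σ i) * (q ⬝ᵥ v i) * (u i ⬝ᵥ e)| := Finset.abs_sum_le_sum_abs _ _
      _ ≤ ∑ i ∈ Finset.univ.filter (fun i : Fin (n ^ 2) => ¬ n ^ 2 - k ≤ (i : ℕ)),
          (1 / σ m) * (|q ⬝ᵥ v i| * |u i ⬝ᵥ e|) := by
        refine Finset.sum_le_sum fun i hi => ?_
        rw [Finset.mem_filter] at hi
        have him : i ≤ m := by
          rw [Fin.le_def]
          omega
        rw [abs_mul, abs_mul, mul_assoc, abs_of_pos (one_div_pos.2 (hσpos i))]
        exact mul_le_mul_of_nonneg_right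
          (one_div_le_one_div_of_le (hσpos m) (hσmono i m him)) (by positivity)
      _ ≤ ∑ i, (1 / σ m) * (|q ⬝ᵥ v i| * |u i ⬝ᵥ e|) := by
        refine Finset.sum_le_sum_of_subset_of_nonneg (Finset.filter_subset _ _) fun i _ _ => ?_
        have := hσpos m
        positivity
      _ = (∑ i, |q ⬝ᵥ v i| * |u i ⬝ᵥ e|) / σ m := by
        rw [← Finset.mul_sum]
        ring
      _ ≤ _ := div_le_div_of_nonneg_right hCS (hσpos m).le
  refine le_trans (le_of_eq ?_) hbound
  rw [← abs_neg]
  congr 1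
  ring
end

section
/- Let G be a finite simple graph on [n] with adjacency matrix A and all vertex degrees positive, let d > 0, and suppose R₁ < 1. Then ‖(P⊗P)(E − I_{n²}) 1_{n²}‖² ≤ (1/(1−R₁)⁴) · ( (1 − 1/n)·(1+R₂)² + (n/d²)·(1+R₁)² ). -/
open Matrix Kronecker BigOperators

/-- squared Euclidean norm bound for `(P⊗P)(E − I) 1_{n²}`. -/
theorem stmt15 (n : ℕ) (A : Matrix (Fin n) (Fin n) ℝ)
    (hsymm : ∀ i j, A i j = A j i) (hdiag : ∀ i, A i i = 0)
    (h01 : ∀ i j, A i j = 0 ∨ A i j = 1)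
    (hdeg : ∀ i, 0 < ∑ j, A i j)
    (d : ℝ) (hd : 0 < d)
    (P : Matrix (Fin n) (Fin n) ℝ)
    (hP : P = Matrix.of fun i j => A i j / ∑ k, A i k)
    (R₁ R₂ : ℝ)
    (hR₁ : R₁ = ⨆ i : Fin n, |(∑ j, A i j) / d - 1|)
    (hR₂ : R₂ = ⨆ q : {q : Fin n × Fin n // q.1 ≠ q.2},
      |((n : ℝ) / d ^ 2) * (∑ i, A i q.1.1 * A i q.1.2) - 1|)
    (hR₁lt : R₁ < 1) :
    ∑ p : Fin n × Fin n, ((((P ⊗ₖ P) * (Ekill n - 1)) *ᵥ fun _ => 1) p) ^ 2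
      ≤ (1 / (1 - R₁) ^ 4) *
          ((1 - 1 / (n : ℝ)) * (1 + R₂) ^ 2 + ((n : ℝ) / d ^ 2) * (1 + R₁) ^ 2) := by
  have hv : ∀ p : Fin n × Fin n, ((((P ⊗ₖ P) * (Ekill n - 1)) *ᵥ fun _ => 1) p)
      = - ((∑ k, A k p.1 * A k p.2) / ((∑ k, A p.1 k) * (∑ k, A p.2 k))) := by
    rintro ⟨i, j⟩
    have hE : (Ekill n - 1) = Matrix.diagonal
        (fun p : Fin n × Fin n => if p.1 = p.2 then (-1 : ℝ) else 0) := by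
      rw [Ekill, ← Matrix.diagonal_one, Matrix.diagonal_sub]
      congr 1
      funext p
      by_cases h : p.1 = p.2 <;> simp [h]
    rw [hE]
    simp only [Matrix.mulVec, dotProduct, Matrix.mul_diagonal, Matrix.kroneckerMap_apply, mul_one,
      Fintype.sum_prod_type, mul_ite, mul_zero, Finset.sum_ite_eq, Finset.mem_univ, if_true, hP,
      Matrix.of_apply]
    rw [Finset.sum_div, ← Finset.sum_neg_distrib]
    refine Finset.sum_congr rfl fun k _ => ?_
    rw [hsymm k i, hsymm k j, div_mul_div_comm]
    ring
  have hA0 : ∀ i j, 0 ≤ A i j := fun i j => by rcases h01 i j with h | h <;> simp [h]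
  rcases Nat.eq_zero_or_pos n with hn | hn
  · subst hn
    simp only [Finset.univ_eq_empty, Finset.sum_empty]
    simp only [Nat.cast_zero, div_zero, sub_zero, zero_div, zero_mul, add_zero]
    positivity
  have hn' : (0 : ℝ) < n := by exact_mod_cast hn
  have h1 : ∀ i, |(∑ j, A i j) / d - 1| ≤ R₁ := fun i => by
    rw [hR₁]
    exact le_ciSup (f := fun i : Fin n => |(∑ j, A i j) / d - 1|) (Set.finite_range _).bddAbove i
  have hR1 : 0 < 1 - R₁ := by linarith
  have hlo : ∀ i, d * (1 - R₁) ≤ ∑ j, A i j := fun i => by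
    have h := (abs_le.1 (h1 i)).1
    have h' : 1 - R₁ ≤ (∑ j, A i j) / d := by linarith
    rw [le_div_iff₀ hd] at h'
    linarith
  have hhi : ∀ i, ∑ j, A i j ≤ d * (1 + R₁) := fun i => by
    have h := (abs_le.1 (h1 i)).2
    have h' : (∑ j, A i j) / d ≤ 1 + R₁ := by linarith
    rw [div_le_iff₀ hd] at h'
    linarith
  have h2 : ∀ i j, i ≠ j → ∑ k, A k i * A k j ≤ d ^ 2 / n * (1 + R₂) := fun i j hij => by
    have h : |((n : ℝ) / d ^ 2) * (∑ k, A k i * A k j) - 1| ≤ R₂ := by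
      rw [hR₂]
      exact le_ciSup (f := fun q : {q : Fin n × Fin n // q.1 ≠ q.2} =>
        |((n : ℝ) / d ^ 2) * (∑ i, A i q.1.1 * A i q.1.2) - 1|)
        (Set.finite_range _).bddAbove ⟨(i, j), hij⟩
    have h' := (abs_le.1 h).2
    have h3 : ((n : ℝ) / d ^ 2) * (∑ k, A k i * A k j) ≤ 1 + R₂ := by linarith
    calc ∑ k, A k i * A k j = d ^ 2 / n * (((n : ℝ) / d ^ 2) * (∑ k, A k i * A k j)) := by
          field_simp
      _ ≤ _ := by gcongr
  have hgen : ∀ (p : Fin n × Fin n) (M : ℝ), ∑ k, A k p.1 * A k p.2 ≤ M →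
      ((((P ⊗ₖ P) * (Ekill n - 1)) *ᵥ fun _ => 1) p) ^ 2
        ≤ 1 / (1 - R₁) ^ 4 * (M ^ 2 / d ^ 4) := fun p M hM => by
    have hc : 0 ≤ ∑ k, A k p.1 * A k p.2 :=
      Finset.sum_nonneg fun k _ => mul_nonneg (hA0 _ _) (hA0 _ _)
    have hpos : 0 < d * (1 - R₁) := mul_pos hd hR1
    rw [hv, neg_sq]
    calc _ ≤ (M / ((d * (1 - R₁)) * (d * (1 - R₁)))) ^ 2 := by
          have hM0 : 0 ≤ M := hc.trans hM
          have ha := hlo p.1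
          have hb := hlo p.2
          have := hdeg p.1
          have := hdeg p.2
          gcongr
      _ = _ := by
          field_simp
  have hb : ∀ p : Fin n × Fin n, ((((P ⊗ₖ P) * (Ekill n - 1)) *ᵥ fun _ => 1) p) ^ 2
      ≤ 1 / (1 - R₁) ^ 4 * ((1 + R₂) ^ 2 / n ^ 2 +
        if p.1 = p.2 then (1 + R₁) ^ 2 / d ^ 2 - (1 + R₂) ^ 2 / n ^ 2 else 0) := fun p => by
    by_cases h : p.1 = p.2
    · refine (hgen p (d * (1 + R₁)) ?_).trans (le_of_eq ?_)
      · refine le_trans (le_of_eq ?_) (hhi p.1)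
        refine Finset.sum_congr rfl fun k _ => ?_
        rw [← h, hsymm k]
        rcases h01 p.1 k with h | h <;> simp [h]
      · rw [if_pos h]
        field_simp
        ring
    · refine (hgen p _ (h2 _ _ h)).trans (le_of_eq ?_)
      rw [if_neg h]
      field_simp
      try ring
  refine (Finset.sum_le_sum fun p _ => hb p).trans (le_of_eq ?_)
  rw [← Finset.mul_sum]
  congr 1
  simp only [Fintype.sum_prod_type, Finset.sum_add_distrib, Finset.sum_ite_eq, Finset.mem_univ,
    if_true, Finset.sum_const, Finset.card_univ, Fintype.card_prod, Fintype.card_fin, nsmul_eq_mul,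
    Nat.cast_mul]
  field_simp
  ring
end
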